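/- arXiv:1409.1821 — 3 statements merged into one kernel-verified Lean document; each statement's English description precedes it below -/
import Mathlib

section
/- Let k be a field of characteristic 2, A = kD₈ the group algebra of the dihedral group of order 8 with generating involutions s, t (st of order 4), J the Jacobson radical of A, and let X be the A-submodule of A/J⁴ generated by the image of s + 1. Then the algebra Γ = End_A(A ⊕ X)^op has dimension 16 over k. -/
set_option synthInstance.maxHeartbeats 1000000
set_option maxHeartbeats 1000000

/-- The Jacobson radical of the group algebra `k D₈`. -/
noncomputable def Jrad (k : Type*) [Field k] : Ideal (MonoidAlgebra k (DihedralGroup 4)) :=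
  Ideal.jacobson ⊥

/-- The fourth power `J⁴` of the Jacobson radical of `k D₈`: the (left) ideal generated by
all products of four elements of `J`. -/
noncomputable def Jrad4 (k : Type*) [Field k] : Ideal (MonoidAlgebra k (DihedralGroup 4)) :=
  Ideal.span {x | ∃ a ∈ Jrad k, ∃ b ∈ Jrad k, ∃ c ∈ Jrad k, ∃ d ∈ Jrad k,
    x = a * b * c * d}

/-- The `k D₈`-submodule `X` of `A / J⁴` generated by the image of `s + 1`. -/
noncomputable def Xmod (k : Type*) [Field k] (s : DihedralGroup 4) :
    Submodule (MonoidAlgebra k (DihedralGroup 4))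
      (MonoidAlgebra k (DihedralGroup 4) ⧸ Jrad4 k) :=
  Submodule.span (MonoidAlgebra k (DihedralGroup 4))
    {Submodule.Quotient.mk (MonoidAlgebra.of k (DihedralGroup 4) s + 1)}

/-- `Γ = End_A(A ⊕ X)ᵒᵖ` for `A = k D₈` and `X ⊆ A/J⁴` generated by the image of `s + 1`. -/
abbrev GammaAlg (k : Type*) [Field k] (s : DihedralGroup 4) :=
  (Module.End (MonoidAlgebra k (DihedralGroup 4))
    (MonoidAlgebra k (DihedralGroup 4) × Xmod k s))ᵐᵒᵖ

theorem ZMod.four_sub :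
    (0 : ZMod 4) - 0 = 0 ∧ (0 : ZMod 4) - 1 = 3 ∧ (0 : ZMod 4) - 2 = 2 ∧ (0 : ZMod 4) - 3 = 1 ∧
    (1 : ZMod 4) - 0 = 1 ∧ (1 : ZMod 4) - 1 = 0 ∧ (1 : ZMod 4) - 2 = 3 ∧ (1 : ZMod 4) - 3 = 2 ∧
    (2 : ZMod 4) - 0 = 2 ∧ (2 : ZMod 4) - 1 = 1 ∧ (2 : ZMod 4) - 2 = 0 ∧ (2 : ZMod 4) - 3 = 3 ∧
    (3 : ZMod 4) - 0 = 3 ∧ (3 : ZMod 4) - 1 = 2 ∧ (3 : ZMod 4) - 2 = 1 ∧ (3 : ZMod 4) - 3 = 0 := by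
  decide

theorem ZMod.four_add :
    (0 : ZMod 4) + 0 = 0 ∧ (0 : ZMod 4) + 1 = 1 ∧ (0 : ZMod 4) + 2 = 2 ∧ (0 : ZMod 4) + 3 = 3 ∧
    (1 : ZMod 4) + 0 = 1 ∧ (1 : ZMod 4) + 1 = 2 ∧ (1 : ZMod 4) + 2 = 3 ∧ (1 : ZMod 4) + 3 = 0 ∧
    (2 : ZMod 4) + 0 = 2 ∧ (2 : ZMod 4) + 1 = 3 ∧ (2 : ZMod 4) + 2 = 0 ∧ (2 : ZMod 4) + 3 = 1 ∧
    (3 : ZMod 4) + 0 = 3 ∧ (3 : ZMod 4) + 1 = 0 ∧ (3 : ZMod 4) + 2 = 1 ∧ (3 : ZMod 4) + 3 = 2 := by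
  decide

theorem ZMod.four_neg :
    -(0 : ZMod 4) = 0 ∧ -(1 : ZMod 4) = 3 ∧ -(2 : ZMod 4) = 2 ∧ -(3 : ZMod 4) = 1 := by
  decide

theorem ZMod.four_cases (i : ZMod 4) : i = 0 ∨ i = 1 ∨ i = 2 ∨ i = 3 := by
  revert i
  decide

namespace DihedralGroup

theorem sum_four {M : Type*} [AddCommMonoid M] (f : DihedralGroup 4 → M) :
    ∑ g, f g = (f (r 0) + f (r 1) + f (r 2) + f (r 3)) +
      (f (sr 0) + f (sr 1) + f (sr 2) + f (sr 3)) := by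
  let e : Fin 4 ⊕ Fin 4 ≃ DihedralGroup 4 :=
    { toFun := Sum.elim (r (n := 4)) (sr (n := 4))
      invFun := fun g => match g with
        | r i => Sum.inl i
        | sr i => Sum.inr i
      left_inv := by rintro (i | i) <;> rfl
      right_inv := by rintro (i | i) <;> rfl }
  rw [← e.sum_comp, Fintype.sum_sum_type, Fin.sum_univ_four, Fin.sum_univ_four]
  rfl

theorem forall_four {P : DihedralGroup 4 → Prop} :
    (∀ g, P g) ↔ (P (r 0) ∧ P (r 1) ∧ P (r 2) ∧ P (r 3)) ∧
      (P (sr 0) ∧ P (sr 1) ∧ P (sr 2) ∧ P (sr 3)) := by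
  refine ⟨fun h => by simp [h], ?_⟩
  rintro ⟨⟨_, _, _, _⟩, _, _, _, _⟩ (i | i) <;> fin_cases i <;> assumption

end DihedralGroup

theorem MonoidAlgebra.coeff_mul_eq_sum {k G : Type*} [Semiring k] [Group G] [Fintype G]
    (x y : MonoidAlgebra k G) (g : G) :
    (x * y).coeff g = ∑ h, x.coeff h * y.coeff (h⁻¹ * g) := by
  rw [MonoidAlgebra.coeff_mul_apply_left, Finsupp.sum_fintype]
  simp

section Radical

open DihedralGroup

variable {k : Type*} [Field k]

theorem coeff_mul_r_zero (x y : MonoidAlgebra k (DihedralGroup 4)) :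
    (x * y).coeff (r 0) =
      (x.coeff (r 0) * y.coeff (r 0) + x.coeff (r 1) * y.coeff (r 3) +
        x.coeff (r 2) * y.coeff (r 2) + x.coeff (r 3) * y.coeff (r 1)) +
      (x.coeff (sr 0) * y.coeff (sr 0) + x.coeff (sr 1) * y.coeff (sr 1) +
        x.coeff (sr 2) * y.coeff (sr 2) + x.coeff (sr 3) * y.coeff (sr 3)) := by
  rw [MonoidAlgebra.coeff_mul_eq_sum, sum_four]
  rfl

theorem coeff_mul_r_one (x y : MonoidAlgebra k (DihedralGroup 4)) :
    (x * y).coeff (r 1) =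
      (x.coeff (r 0) * y.coeff (r 1) + x.coeff (r 1) * y.coeff (r 0) +
        x.coeff (r 2) * y.coeff (r 3) + x.coeff (r 3) * y.coeff (r 2)) +
      (x.coeff (sr 0) * y.coeff (sr 1) + x.coeff (sr 1) * y.coeff (sr 2) +
        x.coeff (sr 2) * y.coeff (sr 3) + x.coeff (sr 3) * y.coeff (sr 0)) := by
  rw [MonoidAlgebra.coeff_mul_eq_sum, sum_four]
  rfl

theorem coeff_mul_r_two (x y : MonoidAlgebra k (DihedralGroup 4)) :
    (x * y).coeff (r 2) =
      (x.coeff (r 0) * y.coeff (r 2) + x.coeff (r 1) * y.coeff (r 1) +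
        x.coeff (r 2) * y.coeff (r 0) + x.coeff (r 3) * y.coeff (r 3)) +
      (x.coeff (sr 0) * y.coeff (sr 2) + x.coeff (sr 1) * y.coeff (sr 3) +
        x.coeff (sr 2) * y.coeff (sr 0) + x.coeff (sr 3) * y.coeff (sr 1)) := by
  rw [MonoidAlgebra.coeff_mul_eq_sum, sum_four]
  rfl

theorem coeff_mul_r_three (x y : MonoidAlgebra k (DihedralGroup 4)) :
    (x * y).coeff (r 3) =
      (x.coeff (r 0) * y.coeff (r 3) + x.coeff (r 1) * y.coeff (r 2) +
        x.coeff (r 2) * y.coeff (r 1) + x.coeff (r 3) * y.coeff (r 0)) +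
      (x.coeff (sr 0) * y.coeff (sr 3) + x.coeff (sr 1) * y.coeff (sr 0) +
        x.coeff (sr 2) * y.coeff (sr 1) + x.coeff (sr 3) * y.coeff (sr 2)) := by
  rw [MonoidAlgebra.coeff_mul_eq_sum, sum_four]
  rfl

theorem coeff_mul_sr_zero (x y : MonoidAlgebra k (DihedralGroup 4)) :
    (x * y).coeff (sr 0) =
      (x.coeff (r 0) * y.coeff (sr 0) + x.coeff (r 1) * y.coeff (sr 1) +
        x.coeff (r 2) * y.coeff (sr 2) + x.coeff (r 3) * y.coeff (sr 3)) +
      (x.coeff (sr 0) * y.coeff (r 0) + x.coeff (sr 1) * y.coeff (r 3) +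
        x.coeff (sr 2) * y.coeff (r 2) + x.coeff (sr 3) * y.coeff (r 1)) := by
  rw [MonoidAlgebra.coeff_mul_eq_sum, sum_four]
  rfl

theorem coeff_mul_sr_one (x y : MonoidAlgebra k (DihedralGroup 4)) :
    (x * y).coeff (sr 1) =
      (x.coeff (r 0) * y.coeff (sr 1) + x.coeff (r 1) * y.coeff (sr 2) +
        x.coeff (r 2) * y.coeff (sr 3) + x.coeff (r 3) * y.coeff (sr 0)) +
      (x.coeff (sr 0) * y.coeff (r 1) + x.coeff (sr 1) * y.coeff (r 0) +
        x.coeff (sr 2) * y.coeff (r 3) + x.coeff (sr 3) * y.coeff (r 2)) := by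
  rw [MonoidAlgebra.coeff_mul_eq_sum, sum_four]
  rfl

theorem coeff_mul_sr_two (x y : MonoidAlgebra k (DihedralGroup 4)) :
    (x * y).coeff (sr 2) =
      (x.coeff (r 0) * y.coeff (sr 2) + x.coeff (r 1) * y.coeff (sr 3) +
        x.coeff (r 2) * y.coeff (sr 0) + x.coeff (r 3) * y.coeff (sr 1)) +
      (x.coeff (sr 0) * y.coeff (r 2) + x.coeff (sr 1) * y.coeff (r 1) +
        x.coeff (sr 2) * y.coeff (r 0) + x.coeff (sr 3) * y.coeff (r 3)) := by
  rw [MonoidAlgebra.coeff_mul_eq_sum, sum_four]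
  rfl

theorem coeff_mul_sr_three (x y : MonoidAlgebra k (DihedralGroup 4)) :
    (x * y).coeff (sr 3) =
      (x.coeff (r 0) * y.coeff (sr 3) + x.coeff (r 1) * y.coeff (sr 0) +
        x.coeff (r 2) * y.coeff (sr 1) + x.coeff (r 3) * y.coeff (sr 2)) +
      (x.coeff (sr 0) * y.coeff (r 3) + x.coeff (sr 1) * y.coeff (r 2) +
        x.coeff (sr 2) * y.coeff (r 1) + x.coeff (sr 3) * y.coeff (r 0)) := by
  rw [MonoidAlgebra.coeff_mul_eq_sum, sum_four]
  rfl

/-- The sum of the coefficients vanishes. -/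
def InAug (x : MonoidAlgebra k (DihedralGroup 4)) : Prop :=
  ∑ g, x.coeff g = 0

/-- The coefficient conditions cutting out the square of the augmentation ideal. -/
def InAugSq (x : MonoidAlgebra k (DihedralGroup 4)) : Prop :=
  x.coeff (r 0) + x.coeff (r 2) = x.coeff (r 1) + x.coeff (r 3) ∧
  x.coeff (r 0) + x.coeff (r 2) = x.coeff (sr 0) + x.coeff (sr 2) ∧
  x.coeff (r 0) + x.coeff (r 2) = x.coeff (sr 1) + x.coeff (sr 3)

/-- The coefficient conditions cutting out the cube of the augmentation ideal. -/
def InAugCube (x : MonoidAlgebra k (DihedralGroup 4)) : Prop :=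
  x.coeff (r 0) = x.coeff (r 2) ∧ x.coeff (r 1) = x.coeff (r 3) ∧
  x.coeff (sr 0) = x.coeff (sr 2) ∧ x.coeff (sr 1) = x.coeff (sr 3) ∧
  x.coeff (r 0) + x.coeff (r 1) + x.coeff (sr 0) + x.coeff (sr 1) = 0

/-- All coefficients agree. -/
def IsConst (x : MonoidAlgebra k (DihedralGroup 4)) : Prop :=
  ∀ g, x.coeff g = x.coeff 1

theorem isConst_iff (x : MonoidAlgebra k (DihedralGroup 4)) :
    IsConst x ↔ (x.coeff (r 1) = x.coeff (r 0) ∧ x.coeff (r 2) = x.coeff (r 0) ∧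
      x.coeff (r 3) = x.coeff (r 0)) ∧ x.coeff (sr 0) = x.coeff (r 0) ∧
      x.coeff (sr 1) = x.coeff (r 0) ∧ x.coeff (sr 2) = x.coeff (r 0) ∧
      x.coeff (sr 3) = x.coeff (r 0) := by
  simp only [IsConst, forall_four, ← r_zero, true_and]

theorem InAug.mul_inAug [CharP k 2] {x y : MonoidAlgebra k (DihedralGroup 4)}
    (hx : InAug x) (hy : InAug y) : InAugSq (x * y) := by
  have h2 : (2 : k) = 0 := CharTwo.two_eq_zero
  unfold InAug InAugSq at *
  simp only [sum_four, coeff_mul_r_zero, coeff_mul_r_one, coeff_mul_r_two, coeff_mul_r_three,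
    coeff_mul_sr_zero, coeff_mul_sr_one, coeff_mul_sr_two, coeff_mul_sr_three] at *
  refine ⟨?_, ?_, ?_⟩ <;> grind

theorem InAug.mul_inAugSq [CharP k 2] {x y : MonoidAlgebra k (DihedralGroup 4)}
    (hx : InAug x) (hy : InAugSq y) : InAugCube (x * y) := by
  have h2 : (2 : k) = 0 := CharTwo.two_eq_zero
  unfold InAug InAugSq InAugCube at *
  simp only [sum_four, coeff_mul_r_zero, coeff_mul_r_one, coeff_mul_r_two, coeff_mul_r_three,
    coeff_mul_sr_zero, coeff_mul_sr_one, coeff_mul_sr_two, coeff_mul_sr_three] at *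
  refine ⟨?_, ?_, ?_, ?_, ?_⟩ <;> grind

theorem InAug.mul_inAugCube [CharP k 2] {x y : MonoidAlgebra k (DihedralGroup 4)}
    (hx : InAug x) (hy : InAugCube y) : IsConst (x * y) := by
  have h2 : (2 : k) = 0 := CharTwo.two_eq_zero
  unfold InAug InAugCube at *
  simp only [isConst_iff, sum_four, coeff_mul_r_zero, coeff_mul_r_one, coeff_mul_r_two,
    coeff_mul_r_three, coeff_mul_sr_zero, coeff_mul_sr_one, coeff_mul_sr_two,
    coeff_mul_sr_three] at *
  refine ⟨⟨?_, ?_, ?_⟩, ?_, ?_, ?_, ?_⟩ <;> grind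

theorem IsConst.mul {x y : MonoidAlgebra k (DihedralGroup 4)} (hy : IsConst y) :
    IsConst (x * y) := by
  unfold IsConst at *
  intro g
  rw [MonoidAlgebra.coeff_mul_eq_sum, MonoidAlgebra.coeff_mul_eq_sum]
  refine Finset.sum_congr rfl fun h _ => ?_
  rw [hy (h⁻¹ * g), hy (h⁻¹ * 1)]

theorem InAug.mul_isConst {x y : MonoidAlgebra k (DihedralGroup 4)} (hx : InAug x)
    (hy : IsConst y) : x * y = 0 := by
  unfold IsConst InAug at *
  ext g
  rw [MonoidAlgebra.coeff_mul_eq_sum]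
  simp_rw [hy (_ * g)]
  rw [← Finset.sum_mul, hx]
  simp

theorem InAug.mul_left {x y : MonoidAlgebra k (DihedralGroup 4)} (hy : InAug y) :
    InAug (x * y) := by
  unfold InAug at *
  simp_rw [MonoidAlgebra.coeff_mul_eq_sum]
  rw [Finset.sum_comm]
  refine Finset.sum_eq_zero fun h _ => ?_
  have hsum := Equiv.sum_comp (Equiv.mulLeft h⁻¹) ⇑y.coeff
  rw [Equiv.coe_mulLeft] at hsum
  rw [← Finset.mul_sum, hsum, hy, mul_zero]

theorem inAug_of_mem_Jrad {x : MonoidAlgebra k (DihedralGroup 4)} (hx : x ∈ Jrad k) :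
    InAug x := by
  let ε : MonoidAlgebra k (DihedralGroup 4) →ₐ[k] k := MonoidAlgebra.lift k k (DihedralGroup 4) 1
  have hε : Function.Surjective ε := fun c => ⟨algebraMap k _ c, ε.commutes c⟩
  have hmax : (RingHom.ker ε).IsMaximal := RingHom.ker_isMaximal_of_surjective ε hε
  have hmem : x ∈ RingHom.ker ε := (Ideal.mem_sInf.mp hx) ⟨bot_le, hmax⟩
  have h0 : ε x = 0 := hmem
  rw [MonoidAlgebra.lift_apply, Finsupp.sum_fintype _ _ (by simp)] at h0
  simpa [InAug] using h0

theorem mem_Jrad_of_inAug [CharP k 2] {x : MonoidAlgebra k (DihedralGroup 4)} (hx : InAug x) :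
    x ∈ Jrad k := by
  refine Ideal.mem_jacobson_iff.mpr fun y => ?_
  have hyx : InAug (y * x) := hx.mul_left
  have hnil : IsNilpotent (y * x) := by
    refine ⟨5, ?_⟩
    rw [pow_succ', pow_succ', pow_succ', pow_succ', pow_one]
    exact hyx.mul_isConst (hyx.mul_inAugCube (hyx.mul_inAugSq (hyx.mul_inAug hyx)))
  obtain ⟨u, hu⟩ := hnil.isUnit_one_add
  refine ⟨↑u⁻¹, ?_⟩
  have h1 : (↑u⁻¹ : MonoidAlgebra k (DihedralGroup 4)) * (1 + y * x) = 1 := by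
    rw [← hu, Units.inv_mul]
  rw [Ideal.mem_bot, mul_assoc, sub_eq_zero, ← h1, mul_add, mul_one, add_comm]

theorem coeff_of_add_one_mul (g h : DihedralGroup 4) (x : MonoidAlgebra k (DihedralGroup 4)) :
    ((MonoidAlgebra.of k _ g + 1) * x).coeff h = x.coeff (g⁻¹ * h) + x.coeff h := by
  simp [add_mul, MonoidAlgebra.of_apply]

theorem coeff_mul_of_add_one (g h : DihedralGroup 4) (x : MonoidAlgebra k (DihedralGroup 4)) :
    (x * (MonoidAlgebra.of k _ g + 1)).coeff h = x.coeff (h * g⁻¹) + x.coeff h := by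
  simp [mul_add, MonoidAlgebra.of_apply]

theorem coeff_of_add_one (g h : DihedralGroup 4) :
    (MonoidAlgebra.of k _ g + 1).coeff h = (if g = h then 1 else 0) + if 1 = h then 1 else 0 := by
  simp [MonoidAlgebra.of_apply, MonoidAlgebra.one_def, Finsupp.single_apply]

theorem mem_Jrad4_iff [CharP k 2] {x : MonoidAlgebra k (DihedralGroup 4)} :
    x ∈ Jrad4 k ↔ IsConst x := by
  have h2 : (2 : k) = 0 := CharTwo.two_eq_zero
  have h4 : (4 : k) = 0 := by linear_combination 2 * h2
  constructor
  · intro hx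
    induction hx using Submodule.span_induction with
    | mem x hx =>
      obtain ⟨a, ha, b, hb, c, hc, d, hd, rfl⟩ := hx
      rw [mul_assoc, mul_assoc]
      exact (inAug_of_mem_Jrad ha).mul_inAugCube ((inAug_of_mem_Jrad hb).mul_inAugSq
        ((inAug_of_mem_Jrad hc).mul_inAug (inAug_of_mem_Jrad hd)))
    | zero => simp [IsConst]
    | add x y _ _ hx hy => intro g; simp [hx g, hy g]
    | smul a x _ hx => exact hx.mul
  · intro hx
    have hmem : ∀ g, MonoidAlgebra.of k (DihedralGroup 4) g + 1 ∈ Jrad k := fun g =>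
      mem_Jrad_of_inAug <| by
        simp [InAug, MonoidAlgebra.of_apply, MonoidAlgebra.one_def, Finset.sum_add_distrib,
          Finsupp.single_apply, one_add_one_eq_two, h2]
    let a := MonoidAlgebra.of k (DihedralGroup 4) (sr 0) + 1
    let b := MonoidAlgebra.of k (DihedralGroup 4) (sr 1) + 1
    have hN : ∀ g, (a * b * a * b).coeff g = 1 := by
      rw [forall_four]
      simp only [a, b, coeff_mul_of_add_one, coeff_of_add_one]
      refine ⟨⟨?_, ?_, ?_, ?_⟩, ?_, ?_, ?_, ?_⟩ <;>
      · simp +decide only [if_true, if_false]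
        grind
    have hx' : x = MonoidAlgebra.single 1 (x.coeff 1) * (a * b * a * b) := by
      ext g
      rw [MonoidAlgebra.coeff_single_mul_apply, hN, hx g, mul_one]
    rw [hx']
    exact Ideal.mul_mem_left _ _ (Submodule.subset_span
      ⟨a, hmem _, b, hmem _, a, hmem _, b, hmem _, rfl⟩)

/-- The generator `(s + 1)(t + 1)` of a left ideal isomorphic to `X`, where `s = sr i` and
`t = sr (i + 1)`. -/
noncomputable def gen (k : Type*) [Field k] (i : ZMod 4) : MonoidAlgebra k (DihedralGroup 4) :=
  (MonoidAlgebra.of k _ (sr i) + 1) * (MonoidAlgebra.of k _ (sr (i + 1)) + 1)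

theorem MonoidAlgebra.eq_iff_four {x y : MonoidAlgebra k (DihedralGroup 4)} :
    x = y ↔ (x.coeff (r 0) = y.coeff (r 0) ∧ x.coeff (r 1) = y.coeff (r 1) ∧
      x.coeff (r 2) = y.coeff (r 2) ∧ x.coeff (r 3) = y.coeff (r 3)) ∧
      x.coeff (sr 0) = y.coeff (sr 0) ∧ x.coeff (sr 1) = y.coeff (sr 1) ∧
      x.coeff (sr 2) = y.coeff (sr 2) ∧ x.coeff (sr 3) = y.coeff (sr 3) := by
  rw [← forall_four (P := fun g => x.coeff g = y.coeff g)]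
  exact ⟨fun h _ => h ▸ rfl, fun h => MonoidAlgebra.ext (DFunLike.ext _ _ h)⟩

theorem mul_gen_eq_zero_iff [CharP k 2] (i : ZMod 4) (c : MonoidAlgebra k (DihedralGroup 4)) :
    c * gen k i = 0 ↔ c * (MonoidAlgebra.of k _ (sr i) + 1) ∈ Jrad4 k := by
  have h2 : (2 : k) = 0 := CharTwo.two_eq_zero
  rw [gen, ← mul_assoc, mem_Jrad4_iff, isConst_iff, MonoidAlgebra.eq_iff_four]
  rcases ZMod.four_cases i with rfl | rfl | rfl | rfl <;>
  · simp only [coeff_mul_of_add_one, inv_sr, r_mul_sr, sr_mul_sr, ZMod.four_sub, ZMod.four_add,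
      MonoidAlgebra.coeff_zero, Finsupp.coe_zero, Pi.zero_apply]
    grind

theorem coeff_mul_gen (i : ZMod 4) (c : MonoidAlgebra k (DihedralGroup 4)) (g : DihedralGroup 4) :
    (c * gen k i).coeff g = c.coeff (g * sr (i + 1) * sr i) + c.coeff (g * sr (i + 1)) +
      (c.coeff (g * sr i) + c.coeff g) := by
  rw [gen, ← mul_assoc, coeff_mul_of_add_one, coeff_mul_of_add_one, coeff_mul_of_add_one,
    inv_sr, inv_sr]

theorem coeff_gen_mul (i : ZMod 4) (c : MonoidAlgebra k (DihedralGroup 4)) (g : DihedralGroup 4) :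
    (gen k i * c).coeff g = c.coeff (sr (i + 1) * (sr i * g)) + c.coeff (sr i * g) +
      (c.coeff (sr (i + 1) * g) + c.coeff g) := by
  rw [gen, mul_assoc, coeff_of_add_one_mul, coeff_of_add_one_mul, coeff_of_add_one_mul,
    inv_sr, inv_sr]

/-- An explicit multiplier reaching prescribed coefficients. -/
noncomputable def multiplier (u v w : k) : MonoidAlgebra k (DihedralGroup 4) :=
  MonoidAlgebra.single (r 0) u + MonoidAlgebra.single (r 1) (u + v) + MonoidAlgebra.single (r 2) w

theorem coeff_multiplier (u v w : k) :
    ((multiplier u v w).coeff (r 0) = u ∧ (multiplier u v w).coeff (r 1) = u + v ∧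
      (multiplier u v w).coeff (r 2) = w ∧ (multiplier u v w).coeff (r 3) = 0) ∧
    (multiplier u v w).coeff (sr 0) = 0 ∧ (multiplier u v w).coeff (sr 1) = 0 ∧
      (multiplier u v w).coeff (sr 2) = 0 ∧ (multiplier u v w).coeff (sr 3) = 0 := by
  refine ⟨⟨?_, ?_, ?_, ?_⟩, ?_, ?_, ?_, ?_⟩ <;>
  · simp only [multiplier, MonoidAlgebra.coeff_add, Finsupp.add_apply, MonoidAlgebra.coeff_single,
      Finsupp.single_apply]
    simp +decide

/-- The equations of the left ideal generated by `gen k i`. -/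
theorem mem_span_gen_iff [CharP k 2] (i : ZMod 4) (m : MonoidAlgebra k (DihedralGroup 4)) :
    m ∈ Submodule.span (MonoidAlgebra k (DihedralGroup 4)) {gen k i} ↔
      m.coeff (sr i) = m.coeff (r 1) ∧ m.coeff (sr (i + 1)) = m.coeff (r 0) ∧
      m.coeff (sr (i + 2)) = m.coeff (r 3) ∧ m.coeff (sr (i + 3)) = m.coeff (r 2) ∧
      m.coeff (r 0) + m.coeff (r 1) + m.coeff (r 2) + m.coeff (r 3) = 0 := by
  have h2 : (2 : k) = 0 := CharTwo.two_eq_zero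
  rw [Submodule.mem_span_singleton]
  constructor
  · rintro ⟨c, rfl⟩
    rw [smul_eq_mul]
    rcases ZMod.four_cases i with rfl | rfl | rfl | rfl <;>
    · simp only [coeff_mul_gen, r_mul_sr, sr_mul_sr, ZMod.four_sub, ZMod.four_add]
      grind
  · intro h
    refine ⟨multiplier (m.coeff (r 0)) (m.coeff (r 1)) (m.coeff (r 3)), ?_⟩
    rw [smul_eq_mul, MonoidAlgebra.eq_iff_four]
    rcases ZMod.four_cases i with rfl | rfl | rfl | rfl <;>
    · simp only [coeff_mul_gen, r_mul_sr, sr_mul_sr, ZMod.four_sub, ZMod.four_add,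
        coeff_multiplier] at h ⊢
      grind

/-- The equations of the right ideal generated by `gen k i`, which is also the annihilator of
the annihilator of `gen k i`. -/
def InRightIdeal (i : ZMod 4) (m : MonoidAlgebra k (DihedralGroup 4)) : Prop :=
  m.coeff (sr i) = m.coeff (r 0) ∧ m.coeff (sr (i + 1)) = m.coeff (r 1) ∧
  m.coeff (sr (i + 2)) = m.coeff (r 2) ∧ m.coeff (sr (i + 3)) = m.coeff (r 3) ∧
  m.coeff (r 0) + m.coeff (r 1) + m.coeff (r 2) + m.coeff (r 3) = 0

theorem inRightIdeal_of_annihilated [CharP k 2] {i : ZMod 4}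
    {m : MonoidAlgebra k (DihedralGroup 4)} (h : ∀ c, c * gen k i = 0 → c * m = 0) :
    InRightIdeal i m := by
  have h2 : (2 : k) = 0 := CharTwo.two_eq_zero
  have ha := h (MonoidAlgebra.of k _ (sr i) + 1) <| by
    rw [MonoidAlgebra.eq_iff_four, gen]
    simp only [coeff_of_add_one_mul, coeff_of_add_one]
    rcases ZMod.four_cases i with rfl | rfl | rfl | rfl <;>
    · simp +decide [h2, one_add_one_eq_two]
  have hb := h (MonoidAlgebra.single (r 0) 1 + MonoidAlgebra.single (r 1) 1 +
      MonoidAlgebra.single (r 2) 1 + MonoidAlgebra.single (r 3) 1) <| by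
    rw [MonoidAlgebra.eq_iff_four]
    rcases ZMod.four_cases i with rfl | rfl | rfl | rfl <;>
    · simp only [coeff_mul_gen, r_mul_sr, sr_mul_sr, ZMod.four_sub, ZMod.four_add,
        MonoidAlgebra.coeff_add, Finsupp.add_apply, MonoidAlgebra.coeff_single,
        Finsupp.single_apply]
      simp +decide [h2, one_add_one_eq_two]
  rw [MonoidAlgebra.eq_iff_four] at ha hb
  unfold InRightIdeal
  rcases ZMod.four_cases i with rfl | rfl | rfl | rfl <;>
  · simp only [coeff_of_add_one_mul, inv_sr, sr_mul_r, sr_mul_sr, ZMod.four_sub, ZMod.four_add,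
      MonoidAlgebra.coeff_zero, Finsupp.coe_zero, Pi.zero_apply] at ha ⊢
    simp only [add_mul, MonoidAlgebra.coeff_add, Finsupp.add_apply,
      MonoidAlgebra.coeff_single_mul_apply, one_mul, inv_r, r_mul_r, ZMod.four_add, ZMod.four_neg,
      MonoidAlgebra.coeff_zero, Finsupp.coe_zero, Pi.zero_apply] at hb
    grind

theorem eq_zero_of_inRightIdeal {i : ZMod 4} {m : MonoidAlgebra k (DihedralGroup 4)}
    (h : InRightIdeal i m) (h0 : m.coeff (r 0) = 0) (h1 : m.coeff (r 1) = 0)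
    (h3 : m.coeff (r 3) = 0) : m = 0 := by
  unfold InRightIdeal at h
  rw [MonoidAlgebra.eq_iff_four]
  rcases ZMod.four_cases i with rfl | rfl | rfl | rfl <;>
  · simp only [ZMod.four_add, MonoidAlgebra.coeff_zero, Finsupp.coe_zero, Pi.zero_apply] at h ⊢
    grind

theorem eq_zero_of_mem_span_gen [CharP k 2] {i : ZMod 4} {m : MonoidAlgebra k (DihedralGroup 4)}
    (h : m ∈ Submodule.span (MonoidAlgebra k (DihedralGroup 4)) {gen k i})
    (h0 : m.coeff (r 0) = 0) (h1 : m.coeff (r 1) = 0) (h3 : m.coeff (r 3) = 0) : m = 0 := by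
  rw [mem_span_gen_iff] at h
  rw [MonoidAlgebra.eq_iff_four]
  rcases ZMod.four_cases i with rfl | rfl | rfl | rfl <;>
  · simp only [ZMod.four_add, MonoidAlgebra.coeff_zero, Finsupp.coe_zero, Pi.zero_apply] at h ⊢
    grind

theorem gen_mul_multiplier_inRightIdeal [CharP k 2] (i : ZMod 4) (u v w : k) :
    InRightIdeal i (gen k i * multiplier u v w) ∧
      (gen k i * multiplier u v w).coeff (r 0) = u ∧
      (gen k i * multiplier u v w).coeff (r 1) = v ∧
      (gen k i * multiplier u v w).coeff (r 3) = w := by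
  have h2 : (2 : k) = 0 := CharTwo.two_eq_zero
  unfold InRightIdeal
  rcases ZMod.four_cases i with rfl | rfl | rfl | rfl <;>
  · simp only [coeff_gen_mul, sr_mul_r, sr_mul_sr, ZMod.four_sub, ZMod.four_add,
      coeff_multiplier]
    grind

theorem multiplier_mul_gen_coeff [CharP k 2] (i : ZMod 4) (u v w : k) :
    (multiplier u v w * gen k i).coeff (r 0) = u ∧
      (multiplier u v w * gen k i).coeff (r 1) = v ∧
      (multiplier u v w * gen k i).coeff (r 3) = w := by
  have h2 : (2 : k) = 0 := CharTwo.two_eq_zero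
  rcases ZMod.four_cases i with rfl | rfl | rfl | rfl <;>
  · simp only [coeff_mul_gen, r_mul_sr, sr_mul_sr, ZMod.four_sub, ZMod.four_add,
      coeff_multiplier]
    grind

/-- A linear map into the group algebra for which a chosen list of coefficients can be prescribed
uniquely identifies its domain with a coordinate space. -/
theorem nonempty_equiv_of_coeff {V : Type*} [AddCommGroup V] [Module k V] {n : ℕ}
    (φ : V →ₗ[k] MonoidAlgebra k (DihedralGroup 4)) (g : Fin n → DihedralGroup 4)
    (hinj : ∀ v, (∀ j, (φ v).coeff (g j) = 0) → v = 0)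
    (hsurj : ∀ w : Fin n → k, ∃ v, ∀ j, (φ v).coeff (g j) = w j) :
    Nonempty (V ≃ₗ[k] (Fin n → k)) := by
  let ψ : V →ₗ[k] (Fin n → k) :=
    { toFun := fun v j => (φ v).coeff (g j)
      map_add' := fun x y => by ext j; simp
      map_smul' := fun c x => by ext j; simp }
  refine ⟨LinearEquiv.ofBijective ψ ⟨?_, fun w => ?_⟩⟩
  · rw [← LinearMap.ker_eq_bot, LinearMap.ker_eq_bot']
    exact fun v hv => hinj v fun j => congrFun hv j
  · obtain ⟨v, hv⟩ := hsurj w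
    exact ⟨v, funext hv⟩

/-- `X` is isomorphic to the left ideal generated by `gen k i`. -/
theorem nonempty_Xmod_equiv [CharP k 2] (i : ZMod 4) :
    Nonempty (Xmod k (sr i) ≃ₗ[MonoidAlgebra k (DihedralGroup 4)]
      Submodule.span (MonoidAlgebra k (DihedralGroup 4)) {gen k i}) := by
  let A := MonoidAlgebra k (DihedralGroup 4)
  let f := LinearMap.toSpanSingleton A (A ⧸ Jrad4 k)
    (Submodule.Quotient.mk (MonoidAlgebra.of k (DihedralGroup 4) (sr i) + 1))
  let f' := LinearMap.toSpanSingleton A A (gen k i)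
  have hker : LinearMap.ker f = LinearMap.ker f' := by
    ext c
    rw [LinearMap.mem_ker, LinearMap.mem_ker, LinearMap.toSpanSingleton_apply,
      LinearMap.toSpanSingleton_apply, smul_eq_mul, mul_gen_eq_zero_iff,
      ← Submodule.Quotient.mk_smul, Submodule.Quotient.mk_eq_zero, smul_eq_mul]
  exact ⟨(LinearEquiv.ofEq _ _ (LinearMap.range_toSpanSingleton _)).symm ≪≫ₗ
    f.quotKerEquivRange.symm ≪≫ₗ Submodule.quotEquivOfEq _ _ hker ≪≫ₗ f'.quotKerEquivRange ≪≫ₗ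
    LinearEquiv.ofEq _ _ (LinearMap.range_toSpanSingleton _)⟩

section Hom

variable {X : Type*} [AddCommGroup X] [Module (MonoidAlgebra k (DihedralGroup 4)) X] {i : ZMod 4}

/-- The generator of `X` corresponding to `gen k i`. -/
noncomputable def cyclicGen
    (e : X ≃ₗ[MonoidAlgebra k (DihedralGroup 4)]
      Submodule.span (MonoidAlgebra k (DihedralGroup 4)) {gen k i}) :
    X :=
  e.symm ⟨gen k i, Submodule.mem_span_singleton_self _⟩

theorem apply_cyclicGen
    (e : X ≃ₗ[MonoidAlgebra k (DihedralGroup 4)]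
      Submodule.span (MonoidAlgebra k (DihedralGroup 4)) {gen k i}) :
    (e (cyclicGen e) : MonoidAlgebra k (DihedralGroup 4)) = gen k i := by
  rw [cyclicGen, e.apply_symm_apply]

theorem smul_cyclicGen_eq_zero
    (e : X ≃ₗ[MonoidAlgebra k (DihedralGroup 4)]
      Submodule.span (MonoidAlgebra k (DihedralGroup 4)) {gen k i})
    {c : MonoidAlgebra k (DihedralGroup 4)} (hc : c * gen k i = 0) :
    c • cyclicGen e = 0 := by
  rw [← e.map_eq_zero_iff, map_smul, ← Submodule.coe_eq_zero, Submodule.coe_smul, apply_cyclicGen,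
    smul_eq_mul, hc]

theorem exists_smul_cyclicGen
    (e : X ≃ₗ[MonoidAlgebra k (DihedralGroup 4)]
      Submodule.span (MonoidAlgebra k (DihedralGroup 4)) {gen k i})
    (x : X) :
    ∃ c : MonoidAlgebra k (DihedralGroup 4), c • cyclicGen e = x := by
  obtain ⟨c, hc⟩ := Submodule.mem_span_singleton.mp (e x).2
  refine ⟨c, e.injective (Subtype.ext ?_)⟩
  rw [map_smul, Submodule.coe_smul, apply_cyclicGen, hc]

theorem hom_eq_zero_of_cyclicGen
    (e : X ≃ₗ[MonoidAlgebra k (DihedralGroup 4)]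
      Submodule.span (MonoidAlgebra k (DihedralGroup 4)) {gen k i})
    {M : Type*} [AddCommGroup M]
    [Module (MonoidAlgebra k (DihedralGroup 4)) M]
    {f : X →ₗ[MonoidAlgebra k (DihedralGroup 4)] M} (hf : f (cyclicGen e) = 0) : f = 0 := by
  ext x
  obtain ⟨c, rfl⟩ := exists_smul_cyclicGen e x
  rw [map_smul, hf, smul_zero, LinearMap.zero_apply]

theorem inRightIdeal_apply_cyclicGen [CharP k 2]
    (e : X ≃ₗ[MonoidAlgebra k (DihedralGroup 4)]
      Submodule.span (MonoidAlgebra k (DihedralGroup 4)) {gen k i})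
    (f : X →ₗ[MonoidAlgebra k (DihedralGroup 4)] MonoidAlgebra k (DihedralGroup 4)) :
    InRightIdeal i (f (cyclicGen e)) :=
  inRightIdeal_of_annihilated fun c hc => by
    rw [← smul_eq_mul, ← map_smul, smul_cyclicGen_eq_zero e hc, map_zero]

theorem nonempty_equiv_fin_three [CharP k 2]
    [Module k X] [IsScalarTower k (MonoidAlgebra k (DihedralGroup 4)) X]
    (e : X ≃ₗ[MonoidAlgebra k (DihedralGroup 4)]
      Submodule.span (MonoidAlgebra k (DihedralGroup 4)) {gen k i}) :
    Nonempty (X ≃ₗ[k] (Fin 3 → k)) := by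
  refine nonempty_equiv_of_coeff
    (((Submodule.subtype _).comp e.toLinearMap).restrictScalars k) ![r 0, r 1, r 3]
    (fun v hv => ?_) (fun w => ?_)
  · have h := eq_zero_of_mem_span_gen (e v).2 (hv 0) (hv 1) (hv 2)
    exact e.map_eq_zero_iff.mp (Subtype.ext h)
  · obtain ⟨h0, h1, h3⟩ := multiplier_mul_gen_coeff i (w 0) (w 1) (w 2)
    refine ⟨multiplier (w 0) (w 1) (w 2) • cyclicGen e, fun j => ?_⟩
    rw [LinearMap.restrictScalars_apply, LinearMap.comp_apply, LinearEquiv.coe_coe, map_smul,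
      Submodule.subtype_apply, Submodule.coe_smul, apply_cyclicGen, smul_eq_mul]
    fin_cases j
    exacts [h0, h1, h3]

theorem nonempty_hom_algebra_equiv [CharP k 2]
    [Module k X] [IsScalarTower k (MonoidAlgebra k (DihedralGroup 4)) X]
    (e : X ≃ₗ[MonoidAlgebra k (DihedralGroup 4)]
      Submodule.span (MonoidAlgebra k (DihedralGroup 4)) {gen k i}) :
    Nonempty ((X →ₗ[MonoidAlgebra k (DihedralGroup 4)] MonoidAlgebra k (DihedralGroup 4)) ≃ₗ[k]
      (Fin 3 → k)) := by
  refine nonempty_equiv_of_coeff (LinearMap.applyₗ' k (cyclicGen e)) ![r 0, r 1, r 3]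
    (fun f hf => ?_) (fun w => ?_)
  · exact hom_eq_zero_of_cyclicGen e
      (eq_zero_of_inRightIdeal (inRightIdeal_apply_cyclicGen e f) (hf 0) (hf 1) (hf 2))
  · obtain ⟨-, h0, h1, h3⟩ := gen_mul_multiplier_inRightIdeal i (w 0) (w 1) (w 2)
    refine ⟨(LinearMap.toSpanSingleton _ _ (multiplier (w 0) (w 1) (w 2))).comp
      ((Submodule.subtype _).comp e.toLinearMap), fun j => ?_⟩
    rw [LinearMap.applyₗ'_apply_apply, LinearMap.comp_apply, LinearMap.comp_apply,
      LinearEquiv.coe_coe, Submodule.subtype_apply, apply_cyclicGen,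
      LinearMap.toSpanSingleton_apply, smul_eq_mul]
    fin_cases j
    exacts [h0, h1, h3]

theorem nonempty_end_equiv [CharP k 2]
    [Module k X] [IsScalarTower k (MonoidAlgebra k (DihedralGroup 4)) X]
    (e : X ≃ₗ[MonoidAlgebra k (DihedralGroup 4)]
      Submodule.span (MonoidAlgebra k (DihedralGroup 4)) {gen k i}) :
    Nonempty ((X →ₗ[MonoidAlgebra k (DihedralGroup 4)] X) ≃ₗ[k] (Fin 2 → k)) := by
  have h2 : (2 : k) = 0 := CharTwo.two_eq_zero
  refine nonempty_equiv_of_coeff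
    ((((Submodule.subtype _).comp e.toLinearMap).restrictScalars k).comp
      (LinearMap.applyₗ' k (cyclicGen e))) ![r 0, r 3] (fun f hf => ?_) (fun w => ?_)
  · have hR : InRightIdeal i ((e (f (cyclicGen e)) : MonoidAlgebra k (DihedralGroup 4))) :=
      inRightIdeal_apply_cyclicGen e (((Submodule.subtype _).comp e.toLinearMap).comp f)
    have hL := (mem_span_gen_iff i _).mp (e (f (cyclicGen e))).2
    have h0 : ((e (f (cyclicGen e)) : MonoidAlgebra k (DihedralGroup 4))).coeff (r 0) = 0 := hf 0
    have h3 : ((e (f (cyclicGen e)) : MonoidAlgebra k (DihedralGroup 4))).coeff (r 3) = 0 := hf 1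
    have h1 := hL.1.symm.trans (hR.1.trans h0)
    exact hom_eq_zero_of_cyclicGen e
      (e.map_eq_zero_iff.mp (Subtype.ext (eq_zero_of_inRightIdeal hR h0 h1 h3)))
  · obtain ⟨hR, h0, h1, h3⟩ := gen_mul_multiplier_inRightIdeal i (w 0) (w 0) (w 1)
    have hmem : gen k i * multiplier (w 0) (w 0) (w 1) ∈
        Submodule.span (MonoidAlgebra k (DihedralGroup 4)) {gen k i} := by
      rw [mem_span_gen_iff]
      unfold InRightIdeal at hR
      grind
    let ρ := (LinearMap.toSpanSingleton _ _ (multiplier (w 0) (w 0) (w 1))).comp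
      ((Submodule.subtype _).comp e.toLinearMap)
    have hρ : ρ (cyclicGen e) = gen k i * multiplier (w 0) (w 0) (w 1) := by
      rw [← apply_cyclicGen e]
      rfl
    have hρ_mem : ∀ x, ρ x ∈ Submodule.span (MonoidAlgebra k (DihedralGroup 4)) {gen k i} := by
      intro x
      obtain ⟨c, rfl⟩ := exists_smul_cyclicGen e x
      rw [map_smul, hρ]
      exact Submodule.smul_mem _ _ hmem
    refine ⟨e.symm.toLinearMap.comp (ρ.codRestrict _ hρ_mem), fun j => ?_⟩
    have hval : ((((Submodule.subtype _).comp e.toLinearMap).restrictScalars k).comp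
        (LinearMap.applyₗ' k (cyclicGen e))) (e.symm.toLinearMap.comp (ρ.codRestrict _ hρ_mem)) =
        gen k i * multiplier (w 0) (w 0) (w 1) := by
      rw [← hρ]
      simp
    rw [hval]
    fin_cases j
    exacts [h0, h3]

theorem finrank_end_prod [CharP k 2]
    [Module k X] [IsScalarTower k (MonoidAlgebra k (DihedralGroup 4)) X]
    (e : X ≃ₗ[MonoidAlgebra k (DihedralGroup 4)]
      Submodule.span (MonoidAlgebra k (DihedralGroup 4)) {gen k i}) :
    Module.finrank k (Module.End (MonoidAlgebra k (DihedralGroup 4))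
      (MonoidAlgebra k (DihedralGroup 4) × X)) = 16 := by
  let A := MonoidAlgebra k (DihedralGroup 4)
  obtain ⟨eAA⟩ : Nonempty (A ≃ₗ[k] (DihedralGroup 4 → k)) :=
    ⟨MonoidAlgebra.coeffLinearEquiv k ≪≫ₗ Finsupp.linearEquivFunOnFinite k k (DihedralGroup 4)⟩
  obtain ⟨eX⟩ := nonempty_equiv_fin_three e
  obtain ⟨eXA⟩ := nonempty_hom_algebra_equiv e
  obtain ⟨eXX⟩ := nonempty_end_equiv e
  have eTotal := (LinearMap.coprodEquiv k (R := A) (M := A) (M₂ := X) (M₃ := A × X)).symm ≪≫ₗ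
    ((LinearMap.prodEquiv k (R := A) (M := A) (M₂ := A) (M₃ := X)).symm ≪≫ₗ
      ((LinearMap.ringLmapEquivSelf A k A ≪≫ₗ eAA).prodCongr
        (LinearMap.ringLmapEquivSelf A k X ≪≫ₗ eX))).prodCongr
    ((LinearMap.prodEquiv k (R := A) (M := X) (M₂ := A) (M₃ := X)).symm ≪≫ₗ eXA.prodCongr eXX)
  refine eTotal.finrank_eq.trans ?_
  simp [DihedralGroup.card]

end Hom

end Radical

/-- Over a field `k` of characteristic `2`, for generating involutions
`s`, `t` of `D₈` (with `s * t` of order `4`), the algebra `Γ = End_{kD₈}(kD₈ ⊕ X)ᵒᵖ`,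
where `X ⊆ kD₈/J⁴` is the submodule generated by the image of `s + 1`, is
`16`-dimensional over `k`. -/
theorem Gamma_dim_sixteen (k : Type*) [Field k] [CharP k 2] (s t : DihedralGroup 4)
    (hs : s ^ 2 = 1) (ht : t ^ 2 = 1) (hst : orderOf (s * t) = 4) :
    Module.finrank k (GammaAlg k s) = 16 := by
  obtain ⟨i, rfl⟩ : ∃ i, s = DihedralGroup.sr i := by
    have h : (s * t) ^ 2 ≠ 1 := fun h => by
      have := Nat.le_of_dvd two_pos (hst ▸ orderOf_dvd_of_pow_eq_one h)
      omega
    clear hst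
    revert s t
    decide
  obtain ⟨e⟩ := nonempty_Xmod_equiv (k := k) i
  exact ((MulOpposite.opLinearEquiv k).symm.finrank_eq).trans (finrank_end_prod e)
end

section
/- Let k be a field of characteristic 2, A = kD₈ the group algebra of the dihedral group of order 8 with generating involutions s, t, J its Jacobson radical, X the A-submodule of A/J⁴ generated by the image of s + 1, and Γ = End_A(A ⊕ X)^op. Then the commutator subspace K(Γ), the k-linear span of all γδ − δγ with γ, δ ∈ Γ, has dimension 11 over k (equivalently, Ann_{D(Γ)}(K(Γ)) = {f ∈ Hom_k(Γ,k) : f(K(Γ)) = 0} has dimension 5). -/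
set_option synthInstance.maxHeartbeats 1000000
set_option maxHeartbeats 1000000

/-- The commutator subspace `K(Γ)`: the `k`-linear span of all commutators `γδ - δγ`. -/
noncomputable def commutatorSubspace (k Γ : Type*) [Field k] [Ring Γ] [Algebra k Γ] :
    Submodule k Γ :=
  Submodule.span k {x : Γ | ∃ a b : Γ, x = a * b - b * a}

/-- A `k`-algebra `A` with the standard monomial basis of the group algebra of the dihedral group
of order `8` in characteristic `2`. -/
structure DihedralPair (k A : Type*) [Field k] [Ring A] [Algebra k A] (x y : A) where
  xx : x * x = 0
  yy : y * y = 0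
  yxyx : y * (x * (y * x)) = x * (y * (x * y))
  basis : Module.Basis (Fin 8) k A
  basis_eq : ⇑basis = ![1, x, y, x * y, y * x, x * (y * x), y * (x * y), x * (y * (x * y))]

namespace DihedralPair

variable {k A : Type*} [Field k] [Ring A] [Algebra k A] {x y : A} (D : DihedralPair k A x y)

theorem xxa (D : DihedralPair k A x y) (a : A) : x * (x * a) = 0 := by rw [← mul_assoc, D.xx, zero_mul]

theorem yya (D : DihedralPair k A x y) (a : A) : y * (y * a) = 0 := by rw [← mul_assoc, D.yy, zero_mul]

theorem yxyxa (D : DihedralPair k A x y) (a : A) : y * (x * (y * (x * a))) = x * (y * (x * (y * a))) := by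
  simpa only [mul_assoc] using congrArg (· * a) D.yxyx

theorem eq_sum (a : A) :
    a = D.basis.repr a 0 • 1 + D.basis.repr a 1 • x + D.basis.repr a 2 • y
      + D.basis.repr a 3 • (x * y) + D.basis.repr a 4 • (y * x) + D.basis.repr a 5 • (x * (y * x))
      + D.basis.repr a 6 • (y * (x * y)) + D.basis.repr a 7 • (x * (y * (x * y))) := by
  conv_lhs => rw [← D.basis.sum_repr a]
  simp [Fin.sum_univ_eight, D.basis_eq]

theorem repr_sum (c : Fin 8 → k) :
    D.basis.repr (c 0 • 1 + c 1 • x + c 2 • y + c 3 • (x * y) + c 4 • (y * x)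
      + c 5 • (x * (y * x)) + c 6 • (y * (x * y)) + c 7 • (x * (y * (x * y)))) = c := by
  conv_rhs => rw [← D.basis.repr_sum_self c]
  simp only [Fin.sum_univ_eight, D.basis_eq, Matrix.cons_val]

theorem repr_mul (a b : A) : ⇑(D.basis.repr (a * b)) =
    ![D.basis.repr a 0 * D.basis.repr b 0,
      D.basis.repr a 0 * D.basis.repr b 1 + D.basis.repr a 1 * D.basis.repr b 0,
      D.basis.repr a 0 * D.basis.repr b 2 + D.basis.repr a 2 * D.basis.repr b 0,
      D.basis.repr a 0 * D.basis.repr b 3 + D.basis.repr a 1 * D.basis.repr b 2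
        + D.basis.repr a 3 * D.basis.repr b 0,
      D.basis.repr a 0 * D.basis.repr b 4 + D.basis.repr a 2 * D.basis.repr b 1
        + D.basis.repr a 4 * D.basis.repr b 0,
      D.basis.repr a 0 * D.basis.repr b 5 + D.basis.repr a 1 * D.basis.repr b 4
        + D.basis.repr a 3 * D.basis.repr b 1 + D.basis.repr a 5 * D.basis.repr b 0,
      D.basis.repr a 0 * D.basis.repr b 6 + D.basis.repr a 2 * D.basis.repr b 3
        + D.basis.repr a 4 * D.basis.repr b 2 + D.basis.repr a 6 * D.basis.repr b 0,
      D.basis.repr a 0 * D.basis.repr b 7 + D.basis.repr a 1 * D.basis.repr b 6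
        + D.basis.repr a 2 * D.basis.repr b 5 + D.basis.repr a 3 * D.basis.repr b 3
        + D.basis.repr a 4 * D.basis.repr b 4 + D.basis.repr a 5 * D.basis.repr b 2
        + D.basis.repr a 6 * D.basis.repr b 1 + D.basis.repr a 7 * D.basis.repr b 0] := by
  rw [← D.repr_sum ![_, _, _, _, _, _, _, _]]
  congr 2
  conv_lhs => rw [D.eq_sum a, D.eq_sum b]
  simp only [mul_add, add_mul, smul_mul_assoc, mul_smul_comm, mul_assoc, one_mul, mul_one, D.xx,
    D.yy, D.xxa, D.yya, D.yxyx, D.yxyxa, mul_zero, smul_zero, add_zero, smul_smul]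
  simp only [Matrix.cons_val]
  module

theorem repr_mul_comm_zero (a b : A) : D.basis.repr (a * b) 0 = D.basis.repr (b * a) 0 := by
  simp only [D.repr_mul, Matrix.cons_val]; ring

theorem repr_mul_comm_one (a b : A) : D.basis.repr (a * b) 1 = D.basis.repr (b * a) 1 := by
  simp only [D.repr_mul, Matrix.cons_val]; ring

theorem repr_mul_comm_two (a b : A) : D.basis.repr (a * b) 2 = D.basis.repr (b * a) 2 := by
  simp only [D.repr_mul, Matrix.cons_val]; ring

theorem repr_mul_comm_three_add_four (a b : A) :
    D.basis.repr (a * b) 3 + D.basis.repr (a * b) 4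
      = D.basis.repr (b * a) 3 + D.basis.repr (b * a) 4 := by
  simp only [D.repr_mul, Matrix.cons_val]; ring

theorem repr_x : ⇑(D.basis.repr x) = ![0, 1, 0, 0, 0, 0, 0, 0] := by
  rw [← D.repr_sum ![0, 1, 0, 0, 0, 0, 0, 0]]; simp

theorem repr_y : ⇑(D.basis.repr y) = ![0, 0, 1, 0, 0, 0, 0, 0] := by
  rw [← D.repr_sum ![0, 0, 1, 0, 0, 0, 0, 0]]; simp

theorem repr_one : ⇑(D.basis.repr 1) = ![1, 0, 0, 0, 0, 0, 0, 0] := by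
  rw [← D.repr_sum ![1, 0, 0, 0, 0, 0, 0, 0]]; simp

end DihedralPair

/-- A dihedral pair together with the three-dimensional uniserial module generated by `u`, subject
to `x • u = 0` and `y • x • y • u = 0`, and its embedding into the regular module. -/
structure DihedralTriple (k : Type*) {A X : Type*} [Field k] [Ring A] [Algebra k A]
    [AddCommGroup X] [Module k X] [Module A X] [IsScalarTower k A X] (x y : A) (u : X)
    extends DihedralPair k A x y where
  xu : x • u = 0
  yxyu : y • x • y • u = 0
  basisX : Module.Basis (Fin 3) k X
  basisX_eq : ⇑basisX = ![u, y • u, x • y • u]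
  emb : X →ₗ[A] A
  emb_u : emb u = x * y

namespace DihedralTriple

variable {k A X : Type*} [Field k] [Ring A] [Algebra k A]
    [AddCommGroup X] [Module k X] [Module A X] [IsScalarTower k A X] {x y : A} {u : X}

/-- The endomorphism of `A × X` with the given blocks. -/
noncomputable def block (a : A) (v : X) (f : X →ₗ[A] A) (h : X →ₗ[A] X) : Module.End A (A × X) :=
  (LinearMap.toSpanSingleton A (A × X) (a, v)).coprod (f.prod h)

theorem block_apply (a : A) (v : X) (f : X →ₗ[A] A) (h : X →ₗ[A] X) (p : A × X) :
    block a v f h p = (p.1 * a + f p.2, p.1 • v + h p.2) := by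
  simp [block]

theorem block_vec_mem (v : X) :
    block 0 v 0 0 ∈ commutatorSubspace k (Module.End A (A × X)) := by
  refine Submodule.subset_span ⟨block 0 v 0 0, block 1 0 0 0, LinearMap.ext fun p ↦ ?_⟩
  simp [block_apply]

theorem block_hom_mem (f : X →ₗ[A] A) :
    block 0 0 f 0 ∈ commutatorSubspace k (Module.End A (A × X)) := by
  refine Submodule.subset_span ⟨block 1 0 0 0, block 0 0 f 0, LinearMap.ext fun p ↦ ?_⟩
  simp [block_apply]

theorem block_commutator_mem (a b : A) :
    block (a * b - b * a) 0 0 0 ∈ commutatorSubspace k (Module.End A (A × X)) := by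
  refine Submodule.subset_span ⟨block b 0 0 0, block a 0 0 0, LinearMap.ext fun p ↦ ?_⟩
  simp [block_apply, mul_sub, mul_assoc]

theorem block_sub_block_mem (f : X →ₗ[A] A) (v : X) :
    block (f v) 0 0 0 - block 0 0 0 (LinearMap.toSpanSingleton A X v ∘ₗ f)
      ∈ commutatorSubspace k (Module.End A (A × X)) := by
  refine Submodule.subset_span ⟨block 0 0 f 0, block 0 v 0 0, LinearMap.ext fun p ↦ ?_⟩
  simp [block_apply]

variable (D : DihedralTriple k x y u)

theorem repr_smul (a : A) (v : X) : ⇑(D.basisX.repr (a • v)) =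
    ![D.basis.repr a 0 * D.basisX.repr v 0,
      D.basis.repr a 0 * D.basisX.repr v 1 + D.basis.repr a 2 * D.basisX.repr v 0,
      D.basis.repr a 0 * D.basisX.repr v 2 + D.basis.repr a 1 * D.basisX.repr v 1
        + D.basis.repr a 3 * D.basisX.repr v 0] := by
  rw [← D.basisX.repr_sum_self ![_, _, _]]
  congr 2
  have yyu : y • y • u = 0 := by rw [smul_smul, D.yy, zero_smul]
  have xxv (w : X) : x • x • w = 0 := by rw [smul_smul, D.xx, zero_smul]
  conv_lhs => rw [D.eq_sum a, ← D.basisX.sum_repr v]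
  simp only [Fin.sum_univ_three, D.basisX_eq, Matrix.cons_val, smul_add, add_smul, smul_assoc,
    mul_smul, one_smul, smul_comm _ (D.basisX.repr v _), D.xu, D.yxyu, yyu, xxv, smul_zero,
    add_zero]
  generalize x • y • u = w₂
  generalize y • u = w₁
  module

theorem exists_eq_smul (v : X) : ∃ a : A, v = a • u ∧
    ⇑(D.basis.repr a) =
      ![D.basisX.repr v 0, 0, D.basisX.repr v 1, D.basisX.repr v 2, 0, 0, 0, 0] := by
  refine ⟨_, ?_, D.repr_sum ![_, _, _, _, _, _, _, _]⟩
  conv_lhs => rw [← D.basisX.sum_repr v]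
  simp [Fin.sum_univ_three, D.basisX_eq, add_smul, mul_smul]

theorem repr_u : ⇑(D.basisX.repr u) = ![1, 0, 0] := by
  rw [← D.basisX.repr_sum_self ![1, 0, 0]]
  simp [Fin.sum_univ_three, D.basisX_eq]

theorem hom_ext (D : DihedralTriple k x y u) {M : Type*} [AddCommGroup M] [Module A M] {f g : X →ₗ[A] M} (h : f u = g u) :
    f = g := by
  ext v
  obtain ⟨a, rfl, -⟩ := D.exists_eq_smul v
  rw [map_smul, map_smul, h]

theorem end_ext (D : DihedralTriple k x y u) {F G : Module.End A (A × X)} (h1 : F (1, 0) = G (1, 0))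
    (h2 : F (0, u) = G (0, u)) : F = G :=
  LinearMap.prod_ext (LinearMap.ext_ring h1) (D.hom_ext h2)

theorem repr_hom_u (f : X →ₗ[A] A) : ⇑(D.basis.repr (f u)) =
    ![0, 0, 0, D.basis.repr (f u) 3, 0, D.basis.repr (f u) 5, 0, D.basis.repr (f u) 7] := by
  have h1 : D.basis.repr (x * f u) = 0 := by
    rw [← smul_eq_mul, ← map_smul, D.xu, map_zero, map_zero]
  have h2 : D.basis.repr (y * (x * (y * f u))) = 0 := by
    simp only [← smul_eq_mul, ← map_smul, D.yxyu, map_zero]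
  have h1' (i : Fin 8) := DFunLike.congr_fun h1 i
  have h2' := DFunLike.congr_fun h2 7
  have e0 := h1' 1
  have e2 := h1' 3
  have e4 := h1' 5
  have e6 := h1' 7
  simp only [D.repr_mul, D.repr_x, D.repr_y, Matrix.cons_val, Finsupp.coe_zero, Pi.zero_apply,
    zero_mul, one_mul, zero_add, add_zero] at e0 e2 e4 e6 h2'
  ext i
  fin_cases i <;> simp [e0, e2, e4, e6, h2']

theorem repr_end_u (h : X →ₗ[A] X) : D.basisX.repr (h u) 1 = 0 := by
  have h1 : D.basisX.repr (x • h u) = 0 := by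
    rw [← map_smul, D.xu, map_zero, map_zero]
  simpa [D.repr_smul, D.repr_x] using DFunLike.congr_fun h1 2

theorem repr_hom (f : X →ₗ[A] A) (v : X) :
    D.basis.repr (f v) 0 = 0 ∧ D.basis.repr (f v) 1 = 0 ∧ D.basis.repr (f v) 2 = 0 ∧
    D.basis.repr (f v) 3 = D.basisX.repr v 0 * D.basis.repr (f u) 3 ∧
    D.basis.repr (f v) 4 = 0 := by
  obtain ⟨a, hv, ha⟩ := D.exists_eq_smul v
  have : f v = a * f u := by conv_lhs => rw [hv, map_smul, smul_eq_mul]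
  rw [this, D.repr_mul, D.repr_hom_u, ha]
  simp

theorem repr_end (h : X →ₗ[A] X) (v : X) :
    D.basisX.repr (h v) 0 = D.basisX.repr (h u) 0 * D.basisX.repr v 0 ∧
    D.basisX.repr (h v) 2 = D.basisX.repr (h u) 0 * D.basisX.repr v 2
      + D.basisX.repr (h u) 2 * D.basisX.repr v 0 := by
  obtain ⟨a, hv, ha⟩ := D.exists_eq_smul v
  have : h v = a • h u := by conv_lhs => rw [hv, map_smul]
  rw [this, D.repr_smul, D.repr_end_u, ha]
  constructor <;> simp <;> ring

/-- The map whose components span the trace forms on `End_A (A × X)`. -/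
noncomputable def traceForms : Module.End A (A × X) →ₗ[k] (Fin 5 → k) where
  toFun F := ![D.basis.repr (F (1, 0)).1 0, D.basis.repr (F (1, 0)).1 1,
    D.basis.repr (F (1, 0)).1 2, D.basisX.repr (F (0, u)).2 0,
    D.basis.repr (F (1, 0)).1 3 + D.basis.repr (F (1, 0)).1 4 + D.basisX.repr (F (0, u)).2 2]
  map_add' F G := by
    ext i
    fin_cases i <;> simp
    ring
  map_smul' c F := by
    ext i
    fin_cases i <;> simp
    ring

theorem traceForms_apply (F : Module.End A (A × X)) :
    D.traceForms F = ![D.basis.repr (F (1, 0)).1 0, D.basis.repr (F (1, 0)).1 1,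
    D.basis.repr (F (1, 0)).1 2, D.basisX.repr (F (0, u)).2 0,
    D.basis.repr (F (1, 0)).1 3 + D.basis.repr (F (1, 0)).1 4 + D.basisX.repr (F (0, u)).2 2] :=
  rfl

theorem exists_eq_block (D : DihedralTriple k x y u) (F : Module.End A (A × X)) : ∃ a v f h, F = block a v f h :=
  ⟨(F (1, 0)).1, (F (1, 0)).2, LinearMap.fst A A X ∘ₗ F ∘ₗ LinearMap.inr A A X,
    LinearMap.snd A A X ∘ₗ F ∘ₗ LinearMap.inr A A X,
    D.end_ext (by simp [block_apply, Prod.mk_zero_zero]) (by simp [block_apply])⟩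

theorem traceForms_block (a : A) (v : X) (f : X →ₗ[A] A) (h : X →ₗ[A] X) :
    D.traceForms (block a v f h) = ![D.basis.repr a 0, D.basis.repr a 1, D.basis.repr a 2,
      D.basisX.repr (h u) 0,
      D.basis.repr a 3 + D.basis.repr a 4 + D.basisX.repr (h u) 2] := by
  simp [traceForms_apply, block_apply]

theorem traceForms_mul_comm (F G : Module.End A (A × X)) :
    D.traceForms (F * G) = D.traceForms (G * F) := by
  obtain ⟨a, v, f, h, rfl⟩ := D.exists_eq_block F
  obtain ⟨b, w, g, l, rfl⟩ := D.exists_eq_block G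
  rw [traceForms_apply, traceForms_apply]
  simp only [Module.End.mul_apply, block_apply, one_mul, map_zero, one_smul,
    zero_mul, zero_smul, add_zero, zero_add]
  simp only [map_add, Finsupp.add_apply]
  rw [D.repr_mul_comm_zero a b, D.repr_mul_comm_one a b, D.repr_mul_comm_two a b]
  have hc := D.repr_mul_comm_three_add_four a b
  simp only [D.repr_smul, Matrix.cons_val, (D.repr_hom f u).1, (D.repr_hom f u).2.1,
    (D.repr_hom g u).1, (D.repr_hom g u).2.1, (D.repr_hom f w).1,
    (D.repr_hom f w).2.1, (D.repr_hom f w).2.2.1, (D.repr_hom f w).2.2.2.1,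
    (D.repr_hom f w).2.2.2.2, (D.repr_hom g v).1,
    (D.repr_hom g v).2.1, (D.repr_hom g v).2.2.1, (D.repr_hom g v).2.2.2.1,
    (D.repr_hom g v).2.2.2.2, (D.repr_end h (l u)).1, (D.repr_end h (l u)).2,
    (D.repr_end l (h u)).1, (D.repr_end l (h u)).2]
  ext i
  fin_cases i
  · rfl
  · rfl
  · rfl
  · simp; ring
  · simp
    linear_combination -hc

theorem traceForms_surjective : Function.Surjective D.traceForms := by
  intro c
  refine ⟨block (∑ i, (![c 0, c 1, c 2, c 4, 0, 0, 0, 0] : Fin 8 → k) i • D.basis i) 0 0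
    (c 3 • LinearMap.id), ?_⟩
  rw [traceForms_block, D.basis.repr_sum_self]
  ext i
  fin_cases i <;> simp [D.repr_u]

theorem ker_traceForms :
    LinearMap.ker D.traceForms = commutatorSubspace k (Module.End A (A × X)) := by
  apply le_antisymm
  · intro F hF
    obtain ⟨a, v, f, h, rfl⟩ := D.exists_eq_block F
    rw [LinearMap.mem_ker, traceForms_block] at hF
    have e0 : D.basis.repr a 0 = 0 := congrFun hF 0
    have e1 : D.basis.repr a 1 = 0 := congrFun hF 1
    have e2 : D.basis.repr a 2 = 0 := congrFun hF 2
    have e3 : D.basisX.repr (h u) 0 = 0 := congrFun hF 3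
    have e4 : D.basis.repr a 3 + D.basis.repr a 4 + D.basisX.repr (h u) 2 = 0 := congrFun hF 4
    have h5 := block_commutator_mem (k := k) (X := X) x (y * x)
    have h6 := block_commutator_mem (k := k) (X := X) y (x * y)
    have h4 := block_commutator_mem (k := k) (X := X) x y
    have h3 := block_sub_block_mem (k := k) D.emb u
    have h7 := block_sub_block_mem (k := k) D.emb (x • y • u)
    have key : block a v f h = block 0 v 0 0 + block 0 0 f 0
        + D.basis.repr a 5 • block (x * (y * x) - y * x * x) 0 0 0
        + D.basis.repr a 6 • block (y * (x * y) - x * y * y) 0 0 0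
        - D.basis.repr a 4 • block (x * y - y * x) 0 0 0
        + (D.basis.repr a 3 + D.basis.repr a 4) • (block (D.emb u) 0 0 0
          - block 0 0 0 (LinearMap.toSpanSingleton A X u ∘ₗ D.emb))
        + D.basis.repr a 7 • (block (D.emb (x • y • u)) 0 0 0
          - block 0 0 0 (LinearMap.toSpanSingleton A X (x • y • u) ∘ₗ D.emb)) := by
      have hh : h u = D.basisX.repr (h u) 2 • x • y • u := by
        conv_lhs => rw [← D.basisX.sum_repr (h u)]
        simp [Fin.sum_univ_three, D.basisX_eq, e3, D.repr_end_u]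
      apply D.end_ext
      · ext
        · simp [block_apply, D.emb_u, mul_assoc, D.xx, D.yy]
          conv_lhs => rw [D.eq_sum a, e0, e1, e2]
          module
        · simp [block_apply]
      · ext
        · simp [block_apply]
        · simp [block_apply, D.emb_u, mul_smul, D.yxyu]
          rw [hh, eq_neg_of_add_eq_zero_right e4, neg_smul]
    rw [key]
    refine add_mem (add_mem (sub_mem (add_mem (add_mem (add_mem (block_vec_mem v)
      (block_hom_mem f)) (Submodule.smul_mem _ _ h5)) (Submodule.smul_mem _ _ h6))
      (Submodule.smul_mem _ _ h4)) (Submodule.smul_mem _ _ h3)) (Submodule.smul_mem _ _ h7)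
  · refine Submodule.span_le.2 ?_
    rintro _ ⟨F, G, rfl⟩
    rw [SetLike.mem_coe, LinearMap.mem_ker, map_sub, D.traceForms_mul_comm, sub_self]

theorem finrank_hom (D : DihedralTriple k x y u) : Module.finrank k (X →ₗ[A] A) = 3 := by
  let e : (X →ₗ[A] A) →ₗ[k] (Fin 3 → k) :=
    { toFun f := ![D.basis.repr (f u) 3, D.basis.repr (f u) 5, D.basis.repr (f u) 7]
      map_add' f g := by simp
      map_smul' c f := by simp }
  have he (f) : e f = ![D.basis.repr (f u) 3, D.basis.repr (f u) 5, D.basis.repr (f u) 7] := rfl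
  have hi : Function.Injective e := by
    intro f g hfg
    apply D.hom_ext
    apply D.basis.repr.injective
    apply DFunLike.coe_injective
    rw [D.repr_hom_u f, D.repr_hom_u g]
    have h3 : D.basis.repr (f u) 3 = D.basis.repr (g u) 3 := congrFun hfg 0
    have h5 : D.basis.repr (f u) 5 = D.basis.repr (g u) 5 := congrFun hfg 1
    have h7 : D.basis.repr (f u) 7 = D.basis.repr (g u) 7 := congrFun hfg 2
    rw [h3, h5, h7]
  have hs : Function.Surjective e := by
    intro q
    refine ⟨LinearMap.toSpanSingleton A A (∑ i, (![q 0, q 1, 0, q 2, 0, 0, 0, 0] : Fin 8 → k) i •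
      D.basis i) ∘ₗ D.emb, ?_⟩
    rw [he, LinearMap.comp_apply, LinearMap.toSpanSingleton_apply, smul_eq_mul, D.emb_u,
      D.repr_mul, D.repr_mul, D.basis.repr_sum_self, D.repr_x, D.repr_y]
    ext i
    fin_cases i <;> simp
  rw [(LinearEquiv.ofBijective e ⟨hi, hs⟩).finrank_eq, Module.finrank_fin_fun]

theorem finrank_end (D : DihedralTriple k x y u) : Module.finrank k (X →ₗ[A] X) = 2 := by
  let e : (X →ₗ[A] X) →ₗ[k] (Fin 2 → k) :=
    { toFun f := ![D.basisX.repr (f u) 0, D.basisX.repr (f u) 2]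
      map_add' f g := by simp
      map_smul' c f := by simp }
  have he (f) : e f = ![D.basisX.repr (f u) 0, D.basisX.repr (f u) 2] := rfl
  have hi : Function.Injective e := by
    intro f g hfg
    apply D.hom_ext
    apply D.basisX.repr.injective
    have h0 : D.basisX.repr (f u) 0 = D.basisX.repr (g u) 0 := congrFun hfg 0
    have h2 : D.basisX.repr (f u) 2 = D.basisX.repr (g u) 2 := congrFun hfg 1
    ext i
    fin_cases i <;> simp [h0, h2, D.repr_end_u]
  have hs : Function.Surjective e := by
    intro q
    refine ⟨q 0 • LinearMap.id + q 1 • LinearMap.toSpanSingleton A X u ∘ₗ D.emb, ?_⟩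
    rw [he]
    ext i
    fin_cases i <;> simp [D.emb_u, D.repr_smul, D.repr_u, D.repr_mul, D.repr_x, D.repr_y]
  rw [(LinearEquiv.ofBijective e ⟨hi, hs⟩).finrank_eq, Module.finrank_fin_fun]

theorem finrank_end_prod (D : DihedralTriple k x y u) : Module.finrank k (Module.End A (A × X)) = 16 := by
  have hA := D.finrank_hom
  have hX := D.finrank_end
  have : Module.Finite k A := .of_basis D.basis
  have : Module.Finite k X := .of_basis D.basisX
  have : Module.Finite k (X →ₗ[A] A) := Module.finite_of_finrank_pos (by omega)
  have : Module.Finite k (X →ₗ[A] X) := Module.finite_of_finrank_pos (by omega)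
  change Module.finrank k (A × X →ₗ[A] A × X) = 16
  rw [← (LinearMap.coprodEquiv k).finrank_eq]
  have : Module.Finite k (A →ₗ[A] A × X) :=
    .equiv (LinearMap.ringLmapEquivSelf A k (A × X)).symm
  have : Module.Finite k (X →ₗ[A] A × X) := .equiv (LinearMap.prodEquiv k)
  rw [Module.finrank_prod, (LinearMap.ringLmapEquivSelf A k (A × X)).finrank_eq,
    ← (LinearMap.prodEquiv k).finrank_eq, Module.finrank_prod, Module.finrank_prod, hA, hX,
    Module.finrank_eq_card_basis D.basis, Module.finrank_eq_card_basis D.basisX,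
    Fintype.card_fin, Fintype.card_fin]

theorem finrank_commutatorSubspace_end (D : DihedralTriple k x y u) :
    Module.finrank k (commutatorSubspace k (Module.End A (A × X))) = 11 := by
  have h16 := D.finrank_end_prod
  have : Module.Finite k (Module.End A (A × X)) := Module.finite_of_finrank_pos (by omega)
  have h := D.traceForms.finrank_range_add_finrank_ker
  rw [LinearMap.range_eq_top.2 D.traceForms_surjective, finrank_top, Module.finrank_fin_fun,
    D.ker_traceForms, h16] at h
  omega

end DihedralTriple

theorem map_op_commutatorSubspace (k R : Type*) [Field k] [Ring R] [Algebra k R] :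
    (commutatorSubspace k R).map (MulOpposite.opLinearEquiv k : R ≃ₗ[k] Rᵐᵒᵖ).toLinearMap =
      commutatorSubspace k Rᵐᵒᵖ := by
  rw [commutatorSubspace, commutatorSubspace, Submodule.map_span]
  congr 1
  ext z
  constructor
  · rintro ⟨_, ⟨a, b, rfl⟩, rfl⟩
    exact ⟨MulOpposite.op b, MulOpposite.op a, by simp⟩
  · rintro ⟨a, b, rfl⟩
    exact ⟨_, ⟨b.unop, a.unop, rfl⟩, by simp⟩

theorem DihedralTriple.finrank_commutatorSubspace {k A X : Type*} [Field k] [Ring A] [Algebra k A]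
    [AddCommGroup X] [Module k X] [Module A X] [IsScalarTower k A X] {x y : A} {u : X}
    (D : DihedralTriple k x y u) :
    Module.finrank k (commutatorSubspace k (Module.End A (A × X))ᵐᵒᵖ) = 11 ∧
    Module.finrank k (commutatorSubspace k (Module.End A (A × X))ᵐᵒᵖ).dualAnnihilator = 5 := by
  have h11 : Module.finrank k (commutatorSubspace k (Module.End A (A × X))ᵐᵒᵖ) = 11 := by
    rw [← map_op_commutatorSubspace, LinearEquiv.finrank_map_eq, D.finrank_commutatorSubspace_end]
  have h16 : Module.finrank k (Module.End A (A × X))ᵐᵒᵖ = 16 := by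
    rw [← (MulOpposite.opLinearEquiv k : _ ≃ₗ[k] (Module.End A (A × X))ᵐᵒᵖ).finrank_eq,
      D.finrank_end_prod]
  have : Module.Finite k (Module.End A (A × X))ᵐᵒᵖ := Module.finite_of_finrank_pos (by omega)
  have := Subspace.finrank_add_finrank_dualAnnihilator_eq
    (commutatorSubspace k (Module.End A (A × X))ᵐᵒᵖ)
  exact ⟨h11, by omega⟩

namespace DihedralPair

section Jacobson

variable {k A : Type*} [Field k] [Ring A] [Algebra k A] {x y : A} (D : DihedralPair k A x y)

theorem isNilpotent {a : A} (ha : D.basis.repr a 0 = 0) : IsNilpotent a := by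
  refine ⟨8, D.basis.repr.injective (DFunLike.coe_injective ?_)⟩
  have : a ^ 8 = ((a * a) * (a * a)) * ((a * a) * (a * a)) := by
    simp only [← sq, ← pow_mul, Nat.reducePow, Nat.reduceMul]
  rw [this]
  ext i
  fin_cases i <;> simp [D.repr_mul, ha]

theorem mem_jacobson_bot_iff {a : A} :
    a ∈ Ideal.jacobson (⊥ : Ideal A) ↔ D.basis.repr a 0 = 0 := by
  rw [Ideal.mem_jacobson_iff]
  constructor
  · intro h
    by_contra h0
    obtain ⟨z, hz⟩ := h (-(D.basis.repr a 0)⁻¹ • 1)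
    rw [Ideal.mem_bot] at hz
    have := congrArg (fun b ↦ D.basis.repr b 0) hz
    simp only [D.repr_mul, D.repr_one, mul_smul_comm, smul_mul_assoc, mul_one, map_sub, map_add,
      map_smul, map_zero, Finsupp.sub_apply, Finsupp.add_apply, Finsupp.smul_apply,
      Finsupp.zero_apply, Matrix.cons_val, smul_eq_mul, neg_mul] at this
    rw [mul_comm (D.basis.repr z 0), inv_mul_cancel_left₀ h0] at this
    simp at this
  · intro h b
    obtain ⟨w, hw⟩ := (D.isNilpotent (a := b * a) (by simp [D.repr_mul, h])).isUnit_add_one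
    exact ⟨↑w⁻¹, by simp [mul_assoc, ← mul_add_one, ← hw]⟩

theorem mem_jacobson_pow_four_iff {a : A} :
    a ∈ Ideal.span {z : A | ∃ a ∈ Ideal.jacobson (⊥ : Ideal A), ∃ b ∈ Ideal.jacobson (⊥ : Ideal A),
      ∃ c ∈ Ideal.jacobson (⊥ : Ideal A), ∃ d ∈ Ideal.jacobson (⊥ : Ideal A),
      z = a * b * c * d} ↔ a = D.basis.repr a 7 • (x * (y * (x * y))) := by
  simp only [D.mem_jacobson_bot_iff]
  constructor
  · intro h
    have (i : Fin 8) (hi : i ≠ 7) : D.basis.repr a i = 0 := by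
      induction h using Submodule.span_induction generalizing i with
      | mem _ h =>
        obtain ⟨a, ha, b, hb, c, hc, d, hd, rfl⟩ := h
        fin_cases i <;> simp [D.repr_mul, ha, hb, hc, hd] at hi ⊢
      | zero => simp
      | add a b _ _ ha hb => simp [ha i hi, hb i hi]
      | smul c a _ ha =>
        have h (j : Fin 8) (hj : j ≠ 7) := ha j hj
        fin_cases i <;> simp [D.repr_mul, h] at hi ⊢
    conv_lhs => rw [D.eq_sum a]
    simp [this]
  · intro h
    rw [h, ← one_mul (x * _), ← smul_mul_assoc, ← smul_eq_mul]
    refine Submodule.smul_mem _ _ (Submodule.subset_span ⟨x, ?_, y, ?_, x, ?_, y, ?_, ?_⟩)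
    all_goals simp [D.repr_x, D.repr_y, mul_assoc]

/-- The submodule of `A / k xyxy` generated by the class of `x` is part of a dihedral triple. -/
noncomputable def triple (I : Ideal A)
    (hI : ∀ a, a ∈ I ↔ a = D.basis.repr a 7 • (x * (y * (x * y)))) :
    DihedralTriple k (X := Submodule.span A {(Submodule.Quotient.mk x : A ⧸ I)}) x y
      ⟨Submodule.Quotient.mk x, Submodule.mem_span_singleton_self _⟩ :=
  let X := Submodule.span A {(Submodule.Quotient.mk x : A ⧸ I)}
  let u : X := ⟨Submodule.Quotient.mk x, Submodule.mem_span_singleton_self _⟩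
  have smul_u (a : A) : (↑(a • u) : A ⧸ I) = Submodule.Quotient.mk (a * x) := rfl
  have smul_u_eq_zero {a : A} (h : a * x ∈ I) : a • u = 0 :=
    Subtype.ext ((Submodule.Quotient.mk_eq_zero I).2 h)
  have h_eight : x * (y * (x * y)) ∈ I := by
    rw [hI, ← one_smul k (x * (y * (x * y)))]
    simp [D.repr_mul, D.repr_x, D.repr_y]
  have xu : x • u = 0 := smul_u_eq_zero (by rw [D.xx]; exact I.zero_mem)
  have yxyu : y • x • y • u = 0 := by
    rw [smul_smul, smul_smul]
    exact smul_u_eq_zero (by rw [mul_assoc, mul_assoc, D.yxyx]; exact h_eight)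
  have li : LinearIndependent k ![u, y • u, x • y • u] := by
    rw [Fintype.linearIndependent_iff]
    intro c hc
    have hm : c 0 • x + c 1 • (y * x) + c 2 • (x * (y * x)) ∈ I := by
      rw [← Submodule.Quotient.mk_eq_zero]
      rw [Fin.sum_univ_three] at hc
      exact congrArg Subtype.val hc
    rw [hI] at hm
    have hr := congrArg (fun a ↦ ⇑(D.basis.repr a)) hm
    have h0 := congrFun hr 1
    have h1 := congrFun hr 4
    have h2 := congrFun hr 5
    simp [D.repr_mul, D.repr_x, D.repr_y] at h0 h1 h2
    intro i
    fin_cases i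
    exacts [h0, h1, h2]
  have sp : ⊤ ≤ Submodule.span k (Set.range ![u, y • u, x • y • u]) := by
    rintro ⟨v, hv⟩ -
    obtain ⟨a, rfl⟩ := Submodule.mem_span_singleton.1 hv
    have e : (⟨a • Submodule.Quotient.mk x, hv⟩ : X) = a • u := rfl
    rw [e, D.eq_sum a]
    simp only [add_smul, smul_assoc, mul_smul, one_smul, xu, yxyu, smul_zero, add_zero]
    refine add_mem (add_mem ?_ ?_) ?_ <;> refine Submodule.smul_mem _ _ (Submodule.subset_span ?_)
    exacts [⟨0, rfl⟩, ⟨1, rfl⟩, ⟨2, rfl⟩]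
  { D with
    xu
    yxyu
    basisX := Module.Basis.mk li sp
    basisX_eq := Module.Basis.coe_mk li sp
    emb := I.liftQ (LinearMap.toSpanSingleton A A y) (fun a ha ↦ by
      rw [LinearMap.mem_ker, LinearMap.toSpanSingleton_apply, (hI a).1 ha]
      simp [mul_assoc, D.yy]) ∘ₗ X.subtype
    emb_u := rfl }

end Jacobson

end DihedralPair

section GroupAlgebra

/-- Two involutions `S`, `T` generating an algebra like the group algebra of the dihedral group of
order `8` in characteristic `2` give the dihedral pair `S + 1`, `T + 1`. -/
noncomputable def DihedralPair.ofInvolutions {k A : Type*} [Field k] [Ring A] [Algebra k A]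
    [CharP A 2] {S T : A} (hS : S * S = 1) (hT : T * T = 1)
    (hST : T * (S * (T * S)) = S * (T * (S * T)))
    (hspan : ∀ W : Submodule k A, 1 ∈ W → (∀ a ∈ W, S * a ∈ W) → (∀ a ∈ W, T * a ∈ W) → W = ⊤)
    (hA : Module.finrank k A = 8) : DihedralPair k A (S + 1) (T + 1) :=
  have sq_eq_zero {R : A} (h : R * R = 1) : (R + 1) * (R + 1) = 0 := by
    rw [add_mul, mul_add, h]
    simp [add_comm R 1, CharTwo.add_self_eq_zero]
  have xx := sq_eq_zero hS
  have yy := sq_eq_zero hT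
  have hyxyx : (T + 1) * ((S + 1) * ((T + 1) * (S + 1)))
      = (S + 1) * ((T + 1) * ((S + 1) * (T + 1))) := by
    obtain ⟨x, hx⟩ : ∃ x, x = S + 1 := ⟨_, rfl⟩
    obtain ⟨y, hy⟩ : ∃ y, y = T + 1 := ⟨_, rfl⟩
    rw [← hx] at xx ⊢
    rw [← hy] at yy ⊢
    rw [eq_sub_of_add_eq hx.symm, eq_sub_of_add_eq hy.symm, ← sub_eq_zero] at hST
    have xxy : x * (x * y) = 0 := by rw [← mul_assoc, xx, zero_mul]
    have yyx : y * (y * x) = 0 := by rw [← mul_assoc, yy, zero_mul]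
    have hz : y * (x * (y * x)) - x * (y * (x * y)) + (2 : ℤ) • (y * x - x * y) = 0 := by
      rw [← hST]
      simp only [mul_sub, sub_mul, xx, yy, xxy, yyx, mul_one, one_mul, mul_zero]
      abel
    rw [← sub_eq_zero, ← hz, two_zsmul, CharTwo.add_self_eq_zero, add_zero]
  let m : Fin 8 → A := ![1, S + 1, T + 1, (S + 1) * (T + 1), (T + 1) * (S + 1),
    (S + 1) * ((T + 1) * (S + 1)), (T + 1) * ((S + 1) * (T + 1)),
    (S + 1) * ((T + 1) * ((S + 1) * (T + 1)))]
  have top : ⊤ ≤ Submodule.span k (Set.range m) := by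
    have sub_mem_of {R : A} (h : ∀ i, (R + 1) * m i ∈ Submodule.span k (Set.range m)) :
        ∀ a ∈ Submodule.span k (Set.range m), R * a ∈ Submodule.span k (Set.range m) := by
      intro a ha
      induction ha using Submodule.span_induction with
      | mem a h' =>
        obtain ⟨i, rfl⟩ := h'
        simpa [add_mul] using sub_mem (h i) (Submodule.subset_span ⟨i, rfl⟩)
      | zero => simp
      | add a b _ _ ha hb => rw [mul_add]; exact add_mem ha hb
      | smul c a _ ha => rw [mul_smul_comm]; exact Submodule.smul_mem _ _ ha
    have xxa (a : A) : (S + 1) * ((S + 1) * a) = 0 := by rw [← mul_assoc, xx, zero_mul]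
    have yya (a : A) : (T + 1) * ((T + 1) * a) = 0 := by rw [← mul_assoc, yy, zero_mul]
    have hm (i : Fin 8) : m i ∈ Submodule.span k (Set.range m) := Submodule.subset_span ⟨i, rfl⟩
    have hz {a : A} (h : a = 0) : a ∈ Submodule.span k (Set.range m) := h ▸ zero_mem _
    refine (hspan _ (hm 0) (sub_mem_of fun i ↦ ?_) (sub_mem_of fun i ↦ ?_)).ge <;> fin_cases i
    · simpa [m] using hm 1
    · exact hz xx
    · exact hm 3
    · exact hz (xxa _)
    · exact hm 5
    · exact hz (xxa _)
    · exact hm 7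
    · exact hz (xxa _)
    · simpa [m] using hm 2
    · exact hm 4
    · exact hz yy
    · exact hm 6
    · exact hz (yya _)
    · exact hyxyx ▸ hm 7
    · exact hz (yya _)
    · refine hz (?_ : (T + 1) * ((S + 1) * ((T + 1) * ((S + 1) * (T + 1)))) = 0)
      simpa only [mul_assoc, yy, mul_zero] using congrArg (· * (T + 1)) hyxyx
  { xx
    yy
    yxyx := hyxyx
    basis := basisOfTopLeSpanOfCardEqFinrank m top (by rw [hA, Fintype.card_fin])
    basis_eq := coe_basisOfTopLeSpanOfCardEqFinrank m top _ }

theorem DihedralGroup.eq_word_of_involutions {s t : DihedralGroup 4} (hs : s ^ 2 = 1)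
    (ht : t ^ 2 = 1) (hst : orderOf (s * t) = 4) :
    t * (s * (t * s)) = s * (t * (s * t)) ∧
    ∀ g, g = 1 ∨ g = s ∨ g = t ∨ g = s * t ∨ g = t * s ∨ g = s * (t * s) ∨ g = t * (s * t) ∨
      g = s * (t * (s * t)) := by
  have h : (s * t) ^ 2 ≠ 1 := fun h ↦ by
    have := orderOf_dvd_of_pow_eq_one h
    rw [hst] at this
    omega
  clear hst
  revert s t
  decide

/-- The dihedral pair `s + 1`, `t + 1` in `k D₈`. -/
noncomputable def dihedralPair (k : Type*) [Field k] [CharP k 2] {s t : DihedralGroup 4}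
    (hs : s ^ 2 = 1) (ht : t ^ 2 = 1) (hst : orderOf (s * t) = 4) :
    DihedralPair k (MonoidAlgebra k (DihedralGroup 4)) (MonoidAlgebra.of k (DihedralGroup 4) s + 1)
      (MonoidAlgebra.of k (DihedralGroup 4) t + 1) :=
  have : CharP (MonoidAlgebra k (DihedralGroup 4)) 2 :=
    charP_of_injective_algebraMap (algebraMap k _).injective 2
  DihedralPair.ofInvolutions
    (by rw [← map_mul, ← sq, hs, map_one]) (by rw [← map_mul, ← sq, ht, map_one])
    (by simp only [← map_mul, (DihedralGroup.eq_word_of_involutions hs ht hst).1])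
    (fun W h1 hS hT ↦ by
      have hof (g : DihedralGroup 4) : MonoidAlgebra.of k (DihedralGroup 4) g ∈ W := by
        rcases (DihedralGroup.eq_word_of_involutions hs ht hst).2 g with
          rfl | rfl | rfl | rfl | rfl | rfl | rfl | rfl
        · rwa [map_one]
        · simpa only [map_mul, mul_one] using hS _ h1
        · simpa only [map_mul, mul_one] using hT _ h1
        · simpa only [map_mul, mul_one] using hS _ (hT _ h1)
        · simpa only [map_mul, mul_one] using hT _ (hS _ h1)
        · simpa only [map_mul, mul_one] using hS _ (hT _ (hS _ h1))
        · simpa only [map_mul, mul_one] using hT _ (hS _ (hT _ h1))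
        · simpa only [map_mul, mul_one] using hS _ (hT _ (hS _ (hT _ h1)))
      refine eq_top_iff.2 fun a _ ↦ ?_
      induction a using MonoidAlgebra.induction_on with
      | of g => exact hof g
      | add a b ha hb => exact add_mem (ha trivial) (hb trivial)
      | smul c a ha => exact W.smul_mem c (ha trivial))
    (by
      rw [Module.finrank_eq_card_basis (MonoidAlgebra.basis (DihedralGroup 4) k)]
      simp [DihedralGroup.card])

end GroupAlgebra

/-- Over a field `k` of characteristic `2`, with `s`, `t` generating
involutions of `D₈` (`s * t` of order `4`), the commutator subspace of
`Γ = End_{kD₈}(kD₈ ⊕ X)ᵒᵖ` is `11`-dimensional; equivalently its annihilator in the dual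
space is `5`-dimensional. -/
theorem commutatorSubspace_Gamma (k : Type*) [Field k] [CharP k 2] (s t : DihedralGroup 4)
    (hs : s ^ 2 = 1) (ht : t ^ 2 = 1) (hst : orderOf (s * t) = 4) :
    Module.finrank k (commutatorSubspace k (GammaAlg k s)) = 11 ∧
    Module.finrank k ((commutatorSubspace k (GammaAlg k s)).dualAnnihilator) = 5 := by
  exact ((dihedralPair k hs ht hst).triple (Jrad4 k) fun _ ↦
    (dihedralPair k hs ht hst).mem_jacobson_pow_four_iff).finrank_commutatorSubspace
end

section
/- The integer matrices C_Λ = (8 1 ; 1 1) and C_Γ = (8 3 ; 3 2) are not congruent over the integers: there is no 2×2 integer matrix M with determinant ±1 such that Mᵀ · C_Λ · M = C_Γ. -/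
/-- The quadratic form `8x² + 2xy + y² = (x + y)² + 7x²` of `(8 1; 1 1)` does not
represent `2` over the integers. -/
theorem eight_sq_add_two_mul_add_sq_ne_two (x y : ℤ) :
    8 * x ^ 2 + 2 * x * y + y ^ 2 ≠ 2 := by
  intro h
  have hx : x = 0 := by
    have : x ^ 2 < 1 := by nlinarith [sq_nonneg (x + y)]
    exact pow_eq_zero_iff two_ne_zero |>.mp (le_antisymm (by lia) (sq_nonneg x))
  subst hx
  have h2 : y ^ 2 = 2 := by linarith
  have hl : -2 < y := by nlinarith
  have hu : y < 2 := by nlinarith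
  interval_cases y <;> omega

/-- The integer matrices `(8 1; 1 1)` and `(8 3; 3 2)` are not congruent
over the integers: there is no integer matrix `M` with `det M = ±1` and
`Mᵀ * (8 1; 1 1) * M = (8 3; 3 2)`. -/
theorem cartan_matrices_not_congruent :
    ¬ ∃ M : Matrix (Fin 2) (Fin 2) ℤ,
        (M.det = 1 ∨ M.det = -1) ∧
        M.transpose * !![(8 : ℤ), 1; 1, 1] * M = !![(8 : ℤ), 3; 3, 2] := by
  rintro ⟨M, -, hM⟩
  have h := congrFun (congrFun hM 1) 1
  simp [Matrix.mul_apply, Fin.sum_univ_two] at h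
  exact eight_sq_add_two_mul_add_sq_ne_two (M 0 1) (M 1 1) (by linarith)
end
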